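/- Let n ∈ ℕ, let Q ∈ [0,1]^{n×n} be a symmetric matrix with zero diagonal, and let d ≥ 5 satisfy Q_ij ≤ d/n for all i,j. Then with probability at least 1 − n^{1−d/4}, a random graph A drawn from G(n,Q) has the following property: for every t ∈ [2e², log n], the number of edges of A having at least one endpoint of degree at least t·d is at most 2·t·e^{−t}·n·d. -/

import Mathlib

open scoped BigOperators Classical

namespace EdgeDensity

/-- A graph on `n` nodes, identified with its Boolean adjacency function:
symmetric with no self-loops. -/
def IsGraph {n : ℕ} (A : Fin n → Fin n → Bool) : Prop :=
  (∀ i j, A i j = A j i) ∧ ∀ i, A i i = false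

/-- The real adjacency matrix of a Boolean graph. -/
def adjMat {n : ℕ} (A : Fin n → Fin n → Bool) : Matrix (Fin n) (Fin n) ℝ :=
  Matrix.of fun i j => if A i j then 1 else 0

/-- `d(M) = (1/n) ∑_{i,j} M i j`, the average row sum. -/
noncomputable def dbar {n : ℕ} (M : Matrix (Fin n) (Fin n) ℝ) : ℝ :=
  (∑ i, ∑ j, M i j) / n

/-- `(M 𝟙)_i = ∑_j M i j`, the `i`-th row sum (degree of node `i`). -/
def rowSum {n : ℕ} (M : Matrix (Fin n) (Fin n) ℝ) (i : Fin n) : ℝ := ∑ j, M i j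

/-- The probability that the inhomogeneous random graph `G(n,Q)` equals the
given graph `A`: each edge `{i,j}` with `i < j` is present independently with
probability `Q i j`. -/
noncomputable def erWeight {n : ℕ} (Q : Matrix (Fin n) (Fin n) ℝ)
    (A : Fin n → Fin n → Bool) : ℝ :=
  ∏ i, ∏ j ∈ Finset.univ.filter (fun j => i < j),
    (if A i j then Q i j else 1 - Q i j)

/-- Probability of the event `E` under the inhomogeneous random graph `G(n,Q)`. -/
noncomputable def erProb {n : ℕ} (Q : Matrix (Fin n) (Fin n) ℝ)
    (E : (Fin n → Fin n → Bool) → Prop) : ℝ :=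
  ∑ A ∈ Finset.univ.filter (fun A => IsGraph A ∧ E A), erWeight Q A

/-- Node distance between two graphs: the minimum cardinality of a set `S` of
nodes such that the two adjacency matrices agree on all entries `(i,j)` with
`i ∉ S` and `j ∉ S`. -/
noncomputable def nodeDist {n : ℕ} (A B : Fin n → Fin n → Bool) : ℕ :=
  sInf {k | ∃ S : Finset (Fin n), S.card = k ∧
    ∀ i j, i ∉ S → j ∉ S → A i j = B i j}

/-- The feasibility constraints `P1(A, γ)` on a pair `(Y, z)`. -/
def P1 {n : ℕ} (A : Matrix (Fin n) (Fin n) ℝ) (γ : ℝ)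
    (Y : Matrix (Fin n) (Fin n) ℝ) (z : Fin n → ℝ) : Prop :=
  (∀ i, z i = 0 ∨ z i = 1) ∧
  ((1 - γ) * n ≤ ∑ i, z i) ∧
  (∀ i j, Y i j = Y j i) ∧
  (∀ i j, 0 ≤ Y i j ∧ Y i j ≤ 1) ∧
  (∀ i j, Y i j * z i * z j = A i j * z i * z j)

/-- The binomial probability mass function `Bin(n,p)` at `k`. -/
noncomputable def binomPMF (n : ℕ) (p : ℝ) (k : ℕ) : ℝ :=
  (n.choose k : ℝ) * p ^ k * (1 - p) ^ (n - k)

/-- Total variation distance between `Bin(n,p)` and `Bin(n,q)`. -/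
noncomputable def binomTV (n : ℕ) (p q : ℝ) : ℝ :=
  (∑ k ∈ Finset.range (n + 1), |binomPMF n p k - binomPMF n q k|) / 2

/-- The spectral norm (largest singular value) of a real square matrix. -/
noncomputable def specNorm {n : ℕ} (M : Matrix (Fin n) (Fin n) ℝ) : ℝ :=
  ‖LinearMap.toContinuousLinearMap (Matrix.toEuclideanLin M)‖

/-- A randomized algorithm on `n`-node graphs is `ε`-differentially
node-private. -/
def IsNodeDP {n : ℕ} (ε : ℝ)
    (𝒜 : (Fin n → Fin n → Bool) → MeasureTheory.Measure ℝ) : Prop :=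
  ∀ G G', IsGraph G → IsGraph G' → nodeDist G G' ≤ 1 →
    ∀ S : Set ℝ, MeasurableSet S →
      𝒜 G S ≤ ENNReal.ofReal (Real.exp ε) * 𝒜 G' S

/-- `Pr_{G ~ G(n,Q), 𝒜}[𝒜(G) ∈ S]`. -/
noncomputable def algProb {n : ℕ} (Q : Matrix (Fin n) (Fin n) ℝ)
    (𝒜 : (Fin n → Fin n → Bool) → MeasureTheory.Measure ℝ) (S : Set ℝ) : ℝ :=
  ∑ A ∈ Finset.univ.filter (fun A => IsGraph A), erWeight Q A * (𝒜 A S).toReal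


theorem sum_sum_eq_sum_lt_add_diag {n : ℕ} (g : Fin n → Fin n → ℝ) :
    ∑ i, ∑ j, g i j =
      (∑ i, ∑ j ∈ Finset.univ.filter (fun j => i < j), (g i j + g j i)) + ∑ i, g i i := by
  have hlt : ∀ i j, g i j = (if i < j then g i j else 0) + (if j < i then g i j else 0) +
      (if i = j then g i j else 0) := by
    intro i j
    rcases lt_trichotomy i j with h | h | h
    · simp [h, h.not_gt, h.ne]
    · simp [h]
    · simp [h, h.not_gt, h.ne']
  calc ∑ i, ∑ j, g i j
      = ∑ i, ∑ j, ((if i < j then g i j else 0) + (if j < i then g i j else 0) +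
          (if i = j then g i j else 0)) :=
        Finset.sum_congr rfl fun i _ => Finset.sum_congr rfl fun j _ => hlt i j
    _ = _ := by
      simp only [Finset.sum_add_distrib, Finset.sum_filter]
      rw [Finset.sum_comm (f := fun i j => if j < i then g i j else 0)]
      simp

/-- Under the product structure of `G(n,Q)`, sums over graphs of products over pairs factorize. -/
theorem sum_isGraph_prod {n : ℕ} (f : Fin n → Fin n → Bool → ℝ) :
    ∑ A ∈ Finset.univ.filter (fun A : Fin n → Fin n → Bool => IsGraph A),
        ∏ i, ∏ j ∈ Finset.univ.filter (fun j => i < j), f i j (A i j) =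
      ∏ i, ∏ j ∈ Finset.univ.filter (fun j => i < j), (f i j true + f i j false) := by
  have hprod : ∀ g : Fin n → Fin n → ℝ,
      ∏ i, ∏ j ∈ Finset.univ.filter (fun j => i < j), g i j =
        ∏ p : {p : Fin n × Fin n // p.1 < p.2}, g p.1.1 p.1.2 := by
    intro g
    simp only [Finset.prod_filter]
    rw [← Fintype.prod_prod_type' (f := fun i j => if i < j then g i j else 1),
      ← Finset.prod_filter]
    exact Finset.prod_subtype _ (by simp) _
  simp only [hprod]
  have hsum : ∀ p : {p : Fin n × Fin n // p.1 < p.2},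
      f p.1.1 p.1.2 true + f p.1.1 p.1.2 false = ∑ b : Bool, f p.1.1 p.1.2 b := by
    intro p
    simp
  simp only [hsum]
  rw [Finset.prod_univ_sum]
  refine Finset.sum_bij' (fun A _ p => A p.1.1 p.1.2)
    (fun B _ i j => if h : i < j then B ⟨(i, j), h⟩ else
      if h : j < i then B ⟨(j, i), h⟩ else false) ?_ ?_ ?_ ?_ ?_
  · simp
  · intro B _
    refine Finset.mem_filter.2 ⟨Finset.mem_univ _, fun i j => ?_, fun i => by simp⟩
    rcases lt_trichotomy i j with h | h | h
    · simp [h, h.not_gt]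
    · simp [h]
    · simp [h, h.not_gt]
  · intro A hA
    obtain ⟨hs, hd⟩ := (Finset.mem_filter.1 hA).2
    funext i j
    rcases lt_trichotomy i j with h | h | h
    · simp [h]
    · simp [h, hd]
    · simp [h, h.not_gt, hs i j]
  · intro B _
    funext p
    simp [p.2]
  · intro A _
    rfl

theorem erWeight_nonneg {n : ℕ} {Q : Matrix (Fin n) (Fin n) ℝ}
    (hQ : ∀ i j, 0 ≤ Q i j ∧ Q i j ≤ 1) (A : Fin n → Fin n → Bool) : 0 ≤ erWeight Q A := by
  refine Finset.prod_nonneg fun i _ => Finset.prod_nonneg fun j _ => ?_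
  split_ifs
  · exact (hQ i j).1
  · linarith [(hQ i j).2]

theorem sum_erWeight {n : ℕ} (Q : Matrix (Fin n) (Fin n) ℝ) :
    ∑ A ∈ Finset.univ.filter (fun A : Fin n → Fin n → Bool => IsGraph A), erWeight Q A = 1 := by
  have h := sum_isGraph_prod (fun i j b => if b then Q i j else 1 - Q i j)
  simpa [erWeight] using h

/-- The edges of `A` with at least one endpoint in `S`. -/
noncomputable def incidentEdges {n : ℕ} (A : Fin n → Fin n → Bool) (S : Finset (Fin n)) :
    Finset (Fin n × Fin n) :=
  Finset.univ.filter fun p => p.1 < p.2 ∧ A p.1 p.2 = true ∧ (p.1 ∈ S ∨ p.2 ∈ S)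

theorem card_incidentEdges {n : ℕ} (A : Fin n → Fin n → Bool) (S : Finset (Fin n)) :
    ((incidentEdges A S).card : ℝ) = ∑ i, ∑ j ∈ Finset.univ.filter (fun j => i < j),
      if A i j = true ∧ (i ∈ S ∨ j ∈ S) then 1 else 0 := by
  simp only [incidentEdges, Finset.card_filter, Finset.sum_filter, Nat.cast_sum,
    Fintype.sum_prod_type]
  refine Finset.sum_congr rfl fun i _ => Finset.sum_congr rfl fun j _ => ?_
  by_cases h : i < j <;> simp [h]

theorem sum_rowSum_le_two_mul_card_incidentEdges {n : ℕ} {A : Fin n → Fin n → Bool}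
    (hA : IsGraph A) (S : Finset (Fin n)) :
    ∑ i ∈ S, rowSum (adjMat A) i ≤ 2 * ((incidentEdges A S).card : ℝ) := by
  have hsum : ∑ i ∈ S, rowSum (adjMat A) i =
      ∑ i, ∑ j, if A i j = true ∧ i ∈ S then (1 : ℝ) else 0 := by
    rw [← Finset.sum_subset (Finset.subset_univ S)]
    · refine Finset.sum_congr rfl fun i hi => ?_
      simp [rowSum, adjMat, hi]
    · intro i _ hi
      simp [hi]
  rw [hsum, sum_sum_eq_sum_lt_add_diag, card_incidentEdges, Finset.mul_sum]
  have hdiag : ∑ i, (if A i i = true ∧ i ∈ S then (1 : ℝ) else 0) = 0 :=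
    Finset.sum_eq_zero fun i _ => by simp [hA.2 i]
  rw [hdiag, add_zero]
  refine Finset.sum_le_sum fun i _ => ?_
  rw [Finset.mul_sum]
  refine Finset.sum_le_sum fun j _ => ?_
  rw [hA.1 j i]
  by_cases h : A i j = true <;> by_cases hi : i ∈ S <;> by_cases hj : j ∈ S <;>
    norm_num [h, hi, hj]

theorem sum_lt_incident_le {n : ℕ} (S : Finset (Fin n)) :
    ∑ i, ∑ j ∈ Finset.univ.filter (fun j => i < j),
      (if i ∈ S ∨ j ∈ S then (1 : ℝ) else 0) ≤ S.card * n := by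
  have htotal : ∑ i : Fin n, ∑ _j : Fin n, (if i ∈ S then (1 : ℝ) else 0) = S.card * n := by
    simp [mul_comm]
  rw [sum_sum_eq_sum_lt_add_diag] at htotal
  have hdiag : 0 ≤ ∑ i, (if i ∈ S then (1 : ℝ) else 0) :=
    Finset.sum_nonneg fun i _ => by positivity
  refine le_trans (Finset.sum_le_sum fun i _ => Finset.sum_le_sum fun j _ => ?_)
    ((le_add_of_nonneg_right hdiag).trans htotal.le)
  by_cases hi : i ∈ S <;> by_cases hj : j ∈ S <;> norm_num [hi, hj]

theorem mgf_card_incidentEdges_le {n : ℕ} {Q : Matrix (Fin n) (Fin n) ℝ} {d : ℝ} (hd : 0 ≤ d)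
    (hQ : ∀ i j, 0 ≤ Q i j ∧ Q i j ≤ 1) (hQd : ∀ i j, Q i j ≤ d / n) (S : Finset (Fin n)) :
    ∑ A ∈ Finset.univ.filter (fun A : Fin n → Fin n → Bool => IsGraph A),
        erWeight Q A * Real.exp (2 * (incidentEdges A S).card) ≤
      Real.exp (S.card * d * Real.exp 2) := by
  have hfactor := sum_isGraph_prod fun i j b =>
    (if b then Q i j else 1 - Q i j) *
      Real.exp (2 * if b = true ∧ (i ∈ S ∨ j ∈ S) then 1 else 0)
  simp only [Finset.prod_mul_distrib, ← Real.exp_sum, ← Finset.mul_sum,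
    ← card_incidentEdges] at hfactor
  unfold erWeight
  rw [hfactor]
  calc _ ≤ ∏ i, ∏ j ∈ Finset.univ.filter (fun j => i < j),
        Real.exp (d / n * Real.exp 2 * if i ∈ S ∨ j ∈ S then 1 else 0) := by
        have hterm : ∀ i j : Fin n,
            0 ≤ Q i j * Real.exp (2 * if i ∈ S ∨ j ∈ S then 1 else 0) + (1 - Q i j) ∧
            Q i j * Real.exp (2 * if i ∈ S ∨ j ∈ S then 1 else 0) + (1 - Q i j) ≤
              Real.exp (d / n * Real.exp 2 * if i ∈ S ∨ j ∈ S then 1 else 0) := by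
          intro i j
          have h0 := (hQ i j).1
          have h1 := (hQ i j).2
          refine ⟨add_nonneg (mul_nonneg h0 (Real.exp_pos _).le) (by linarith), ?_⟩
          split_ifs
          · have h2 := mul_le_mul_of_nonneg_right (hQd i j) (Real.exp_pos 2).le
            have h3 := Real.add_one_le_exp (d / n * Real.exp 2)
            simp only [mul_one]
            linarith
          · simp
        refine Finset.prod_le_prod (fun i _ => Finset.prod_nonneg fun j _ => ?_) fun i _ =>
          Finset.prod_le_prod (fun j _ => ?_) fun j _ => ?_
        · simpa using (hterm i j).1
        · simpa using (hterm i j).1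
        · simpa using (hterm i j).2
    _ = Real.exp (d / n * Real.exp 2 * ∑ i, ∑ j ∈ Finset.univ.filter (fun j => i < j),
          if i ∈ S ∨ j ∈ S then 1 else 0) := by
        simp only [← Real.exp_sum, ← Finset.mul_sum]
    _ ≤ _ := by
        refine Real.exp_le_exp.2 ((mul_le_mul_of_nonneg_left (sum_lt_incident_le S)
          (by positivity)).trans ?_)
        rcases Nat.eq_zero_or_pos n with rfl | hn
        · simp only [Nat.cast_zero, div_zero, zero_mul]
          positivity
        · have : (n : ℝ) ≠ 0 := by positivity
          refine le_of_eq ?_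
          field_simp

/-- The exponential rate used for the sets of `s` nodes in the union bound. -/
noncomputable def unionRate (n s : ℕ) : ℝ :=
  max (Real.log (4 * n / s)) (2 * Real.exp 2)

theorem choose_le_exp_mul_log {n s : ℕ} (hs : 0 < s) (hsn : s ≤ n) :
    (n.choose s : ℝ) ≤ Real.exp (s * Real.log (4 * n / s)) := by
  have hs' : (0 : ℝ) < s := by exact_mod_cast hs
  have hn' : (0 : ℝ) < n := by exact_mod_cast hs.trans_le hsn
  have hfac : (s : ℝ) ^ s / s.factorial ≤ 4 ^ s :=
    calc (s : ℝ) ^ s / s.factorial ≤ Real.exp s := Real.pow_div_factorial_le_exp _ hs'.le _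
      _ = Real.exp 1 ^ s := by rw [← Real.exp_nat_mul, mul_one]
      _ ≤ 4 ^ s := by
        gcongr
        linarith [Real.exp_one_lt_d9]
  calc (n.choose s : ℝ) ≤ n ^ s / s.factorial := Nat.choose_le_pow_div s n
    _ = (n / s) ^ s * (s ^ s / s.factorial) := by
      rw [div_pow]
      field_simp
    _ ≤ (n / s) ^ s * 4 ^ s := by gcongr
    _ = (4 * n / s) ^ s := by
      rw [← mul_pow]
      ring
    _ = Real.exp (s * Real.log (4 * n / s)) := by
      rw [Real.exp_nat_mul, Real.exp_log (by positivity)]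

theorem log_le_mul_log_four_mul_div {n s : ℕ} (hs : 0 < s) (hsn : s ≤ n) :
    Real.log n ≤ s * Real.log (4 * n / s) := by
  have hs' : (1 : ℝ) ≤ s := by exact_mod_cast hs
  have hn' : (s : ℝ) ≤ n := by exact_mod_cast hsn
  have hlog4 : 1 ≤ Real.log 4 := by
    rw [Real.le_log_iff_exp_le (by norm_num)]
    linarith [Real.exp_one_lt_d9]
  have hlog : Real.log s ≤ Real.log n := Real.log_le_log (by linarith) hn'
  have hlogs := Real.log_le_sub_one_of_pos (show (0 : ℝ) < s by linarith)
  have hs0 : (s : ℝ) ≠ 0 := by linarith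
  have hn0 : (n : ℝ) ≠ 0 := by linarith
  rw [Real.log_div (mul_ne_zero four_ne_zero hn0) hs0, Real.log_mul four_ne_zero hn0]
  nlinarith

theorem choose_mul_exp_unionRate_le {n s : ℕ} (hs : 0 < s) (hsn : s ≤ n) {d : ℝ} (hd : 5 ≤ d) :
    n.choose s * Real.exp (-(s * d * unionRate n s / 2)) ≤ (n : ℝ) ^ (1 - d / 2) := by
  have hn : (0 : ℝ) < n := by exact_mod_cast hs.trans_le hsn
  have hmax : s * Real.log (4 * n / s) ≤ s * unionRate n s :=
    mul_le_mul_of_nonneg_left (le_max_left _ _) (Nat.cast_nonneg s)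
  have hlog := log_le_mul_log_four_mul_div hs hsn
  calc n.choose s * Real.exp (-(s * d * unionRate n s / 2))
      ≤ Real.exp (s * unionRate n s) * Real.exp (-(s * d * unionRate n s / 2)) := by
        gcongr
        exact (choose_le_exp_mul_log hs hsn).trans (Real.exp_le_exp.2 hmax)
    _ = Real.exp (s * unionRate n s * (1 - d / 2)) := by
        rw [← Real.exp_add]
        ring_nf
    _ ≤ Real.exp (Real.log n * (1 - d / 2)) :=
        Real.exp_le_exp.2 (mul_le_mul_of_nonpos_right (hlog.trans hmax) (by linarith))
    _ = _ := (Real.rpow_def_of_pos hn _).symm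

theorem sum_nonempty_exp_unionRate_le (n : ℕ) {d : ℝ} (hd : 5 ≤ d) :
    ∑ S ∈ Finset.univ.filter (fun S : Finset (Fin n) => S.Nonempty),
      Real.exp (-(S.card * d * unionRate n S.card / 2)) ≤ (n : ℝ) ^ (1 - d / 4) := by
  have hcard : ∑ S ∈ Finset.univ.filter (fun S : Finset (Fin n) => S.Nonempty),
      Real.exp (-(S.card * d * unionRate n S.card / 2)) =
      ∑ s ∈ Finset.range n, (n.choose (s + 1) : ℝ) *
        Real.exp (-((s + 1 : ℕ) * d * unionRate n (s + 1) / 2)) := by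
    have h := Finset.sum_powerset_apply_card (fun s : ℕ =>
      if 0 < s then Real.exp (-(s * d * unionRate n s / 2)) else 0)
      (x := (Finset.univ : Finset (Fin n)))
    rw [Finset.card_univ, Fintype.card_fin, Finset.sum_range_succ'] at h
    simpa [Finset.sum_filter, Finset.card_pos] using h
  rw [hcard]
  rcases Nat.eq_zero_or_pos n with rfl | hn
  · simpa using Real.rpow_nonneg le_rfl _
  have hn' : (1 : ℝ) ≤ n := by exact_mod_cast hn
  calc _ ≤ ∑ _s ∈ Finset.range n, (n : ℝ) ^ (1 - d / 2) :=
        Finset.sum_le_sum fun s hs => choose_mul_exp_unionRate_le s.succ_pos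
          (Finset.mem_range.1 hs) hd
    _ = (n : ℝ) ^ (1 + (1 - d / 2)) := by
        rw [Real.rpow_add (by linarith), Real.rpow_one]
        simp
    _ ≤ _ := Real.rpow_le_rpow_of_exponent_le hn' (by linarith)

theorem mul_exp_neg_le_of_one_le {t u : ℝ} (ht : 1 ≤ t) (htu : t ≤ u) :
    u * Real.exp (-u) ≤ t * Real.exp (-t) := by
  have h : u ≤ t * Real.exp (u - t) := by
    nlinarith [Real.add_one_le_exp (u - t)]
  calc u * Real.exp (-u) ≤ t * Real.exp (u - t) * Real.exp (-u) := by gcongr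
    _ = t * Real.exp (-t) := by
      rw [mul_assoc, ← Real.exp_add]
      ring_nf

/-- If no node set is incident to too many edges, then few edges meet high-degree nodes. -/
theorem card_incidentEdges_highDegree_le {n : ℕ} {A : Fin n → Fin n → Bool} (hA : IsGraph A)
    {d : ℝ} (hd : 0 ≤ d)
    (hS : ∀ S : Finset (Fin n), S.Nonempty →
      ((incidentEdges A S).card : ℝ) < S.card * d * unionRate n S.card / 2)
    {t : ℝ} (ht : 2 * Real.exp 2 ≤ t) :
    ((incidentEdges A (Finset.univ.filter fun i => t * d ≤ rowSum (adjMat A) i)).card : ℝ) ≤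
      2 * t * Real.exp (-t) * n * d := by
  set T := Finset.univ.filter fun i => t * d ≤ rowSum (adjMat A) i with hT
  have ht1 : 1 ≤ t := by linarith [Real.one_le_exp (show (0 : ℝ) ≤ 2 by norm_num)]
  rcases T.eq_empty_or_nonempty with hempty | hne
  · rw [hempty]
    simp only [incidentEdges, Finset.notMem_empty, or_self, and_false, Finset.filter_false,
      Finset.card_empty, Nat.cast_zero]
    positivity
  have hs : (0 : ℝ) < T.card := by exact_mod_cast hne.card_pos
  have hn : (0 : ℝ) < n := by
    obtain ⟨i, _⟩ := hne
    exact_mod_cast i.pos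
  have hdeg : T.card * (t * d) ≤ 2 * ((incidentEdges A T).card : ℝ) := by
    refine le_trans ?_ (sum_rowSum_le_two_mul_card_incidentEdges hA T)
    rw [← nsmul_eq_mul]
    exact Finset.card_nsmul_le_sum _ _ _ fun i hi => (Finset.mem_filter.1 hi).2
  have hlt := hS T hne
  have htu : t < unionRate n T.card := by
    by_contra! hle
    have : T.card * d * unionRate n T.card ≤ T.card * d * t := by gcongr
    linarith
  have hrate : unionRate n T.card = Real.log (4 * n / T.card) := by
    refine max_eq_left (le_of_not_gt fun h => ?_)
    rw [unionRate, max_eq_right h.le] at htu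
    linarith
  have hexp : (T.card : ℝ) = 4 * n * Real.exp (-unionRate n T.card) := by
    rw [hrate, Real.exp_neg, Real.exp_log (by positivity)]
    field_simp
  have hmono := mul_exp_neg_le_of_one_le ht1 htu.le
  calc ((incidentEdges A T).card : ℝ) ≤ T.card * d * unionRate n T.card / 2 := hlt.le
    _ = 2 * n * d * (unionRate n T.card * Real.exp (-unionRate n T.card)) := by
      nth_rewrite 1 [hexp]
      ring
    _ ≤ 2 * n * d * (t * Real.exp (-t)) := by gcongr
    _ = _ := by ring

theorem one_sub_sum_le_erProb {n : ℕ} {Q : Matrix (Fin n) (Fin n) ℝ}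
    (hQ : ∀ i j, 0 ≤ Q i j ∧ Q i j ≤ 1) (E : (Fin n → Fin n → Bool) → Prop)
    (g : (Fin n → Fin n → Bool) → ℝ) (hg : ∀ A, 0 ≤ g A)
    (hE : ∀ A, IsGraph A → ¬ E A → 1 ≤ g A) :
    1 - ∑ A ∈ Finset.univ.filter (fun A : Fin n → Fin n → Bool => IsGraph A),
      erWeight Q A * g A ≤ erProb Q E := by
  rw [← sum_erWeight Q, erProb, ← Finset.filter_filter, Finset.sum_filter (p := E),
    ← Finset.sum_sub_distrib]
  refine Finset.sum_le_sum fun A hA => ?_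
  have hw := erWeight_nonneg hQ A
  split_ifs with h
  · linarith [mul_nonneg hw (hg A)]
  · nlinarith [hE A (Finset.mem_filter.1 hA).2 h]

/-- degree pruning: few edges are incident to high-degree
nodes. -/
theorem degree_pruning (n : ℕ) (Q : Matrix (Fin n) (Fin n) ℝ)
    (hsym : ∀ i j, Q i j = Q j i) (hdiag : ∀ i, Q i i = 0)
    (hrange : ∀ i j, 0 ≤ Q i j ∧ Q i j ≤ 1)
    (d : ℝ) (hd : 5 ≤ d) (hQd : ∀ i j, Q i j ≤ d / n) :
    1 - (n : ℝ) ^ (1 - d / 4) ≤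
      erProb Q (fun A => ∀ t : ℝ, 2 * Real.exp 2 ≤ t → t ≤ Real.log n →
        ((Finset.univ.filter fun p : Fin n × Fin n =>
            p.1 < p.2 ∧ A p.1 p.2 = true ∧
              (t * d ≤ rowSum (adjMat A) p.1 ∨ t * d ≤ rowSum (adjMat A) p.2)).card : ℝ)
          ≤ 2 * t * Real.exp (-t) * n * d) := by
  have hexp2 := Real.exp_pos 2
  refine le_trans (sub_le_sub_left ?_ 1) (one_sub_sum_le_erProb hrange _
    (fun A => ∑ S ∈ Finset.univ.filter (fun S : Finset (Fin n) => S.Nonempty),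
      Real.exp (2 * (incidentEdges A S).card) *
        Real.exp (-(S.card * d * unionRate n S.card)))
    (fun A => by positivity) ?_)
  · refine le_trans ?_ (sum_nonempty_exp_unionRate_le n hd)
    simp only [Finset.mul_sum]
    rw [Finset.sum_comm]
    refine Finset.sum_le_sum fun S _ => ?_
    simp only [← mul_assoc]
    rw [← Finset.sum_mul]
    calc _ ≤ Real.exp (S.card * d * Real.exp 2) *
          Real.exp (-(S.card * d * unionRate n S.card)) := by
          gcongr
          exact mgf_card_incidentEdges_le (by linarith) hrange hQd S
      _ ≤ _ := by
          rw [← Real.exp_add]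
          refine Real.exp_le_exp.2 ?_
          have hrate : 2 * Real.exp 2 ≤ unionRate n S.card := le_max_right _ _
          have : S.card * d * (2 * Real.exp 2) ≤ S.card * d * unionRate n S.card := by gcongr
          linarith
  · intro A hA hbad
    by_contra! hlt
    refine hbad fun t ht _ => ?_
    have h := card_incidentEdges_highDegree_le hA (d := d) (by linarith) (fun S hS => ?_) ht
    · simpa [incidentEdges] using h
    · by_contra! hle
      have hone : 1 ≤ Real.exp (2 * (incidentEdges A S).card) *
          Real.exp (-(S.card * d * unionRate n S.card)) := by
        rw [← Real.exp_add]
        exact Real.one_le_exp (by linarith)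
      refine absurd (hone.trans (Finset.single_le_sum (f := fun S : Finset (Fin n) =>
        Real.exp (2 * (incidentEdges A S).card) *
          Real.exp (-(S.card * d * unionRate n S.card))) (fun S _ => by positivity)
        (Finset.mem_filter.2 ⟨Finset.mem_univ S, hS⟩))) hlt.not_ge

end EdgeDensity
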